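/- Let S, Δ ∈ ℝ^{N×N}, set Ŝ := S + Δ, D := diag(S𝟏), E := diag(Δ𝟏), D̂ := D + E, with all diagonal entries of D positive and s_min := min_i D_{ii}, and suppose ‖E‖₂ ≤ s_min/2. Let V ∈ ℝ^{N×d}, and define O := D^{-1}S·V and Ô := D̂^{-1}Ŝ·V. Then ‖Ô − O‖_F ≤ (2/s_min + 2‖S‖₂√N/s_min²) · ‖Δ‖₂ · ‖V‖_F. -/

import Mathlib

open Matrix

/-- Spectral norm (operator norm induced by the Euclidean norm) of a real matrix. -/
noncomputable def specNorm {m n : ℕ} (M : Matrix (Fin m) (Fin n) ℝ) : ℝ :=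
  ‖LinearMap.toContinuousLinearMap (Matrix.toEuclideanLin M)‖

/-- Frobenius norm of a real matrix. -/
noncomputable def frobNorm {m n : ℕ} (M : Matrix (Fin m) (Fin n) ℝ) : ℝ :=
  Real.sqrt (∑ i, ∑ j, (M i j) ^ 2)

/-- The row-normalization diagonal matrix `diag(M𝟏)` of a square real matrix. -/
noncomputable def rowSumDiag {N : ℕ} (M : Matrix (Fin N) (Fin N) ℝ) :
    Matrix (Fin N) (Fin N) ℝ :=
  Matrix.diagonal fun i => ∑ j, M i j

open scoped Matrix.Norms.L2Operator in
lemma specNorm_eq_l2_opNorm {m n : ℕ} (M : Matrix (Fin m) (Fin n) ℝ) : specNorm M = ‖M‖ := rfl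

lemma specNorm_nonneg {m n : ℕ} (M : Matrix (Fin m) (Fin n) ℝ) : 0 ≤ specNorm M :=
  norm_nonneg _

open scoped Matrix.Norms.L2Operator in
lemma specNorm_sub_le {m n : ℕ} (A B : Matrix (Fin m) (Fin n) ℝ) :
    specNorm (A - B) ≤ specNorm A + specNorm B := by
  simpa only [specNorm_eq_l2_opNorm] using norm_sub_le A B

open scoped Matrix.Norms.L2Operator in
lemma specNorm_mul_le {l m n : ℕ} (A : Matrix (Fin l) (Fin m) ℝ) (B : Matrix (Fin m) (Fin n) ℝ) :
    specNorm (A * B) ≤ specNorm A * specNorm B := by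
  simpa only [specNorm_eq_l2_opNorm] using Matrix.l2_opNorm_mul A B

open scoped Matrix.Norms.L2Operator in
lemma specNorm_diagonal {n : ℕ} (v : Fin n → ℝ) : specNorm (diagonal v) = ‖v‖ := by
  rw [specNorm_eq_l2_opNorm, Matrix.l2_opNorm_diagonal]

lemma sqrt_sum_sq_mulVec_le {m n : ℕ} (A : Matrix (Fin m) (Fin n) ℝ) (x : Fin n → ℝ) :
    √(∑ i, (A *ᵥ x) i ^ 2) ≤ specNorm A * √(∑ j, x j ^ 2) := by
  simpa [specNorm, EuclideanSpace.norm_eq] using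
    (LinearMap.toContinuousLinearMap (Matrix.toEuclideanLin A)).le_opNorm (WithLp.toLp 2 x)

lemma frobNorm_mul_le {l m n : ℕ} (A : Matrix (Fin l) (Fin m) ℝ) (B : Matrix (Fin m) (Fin n) ℝ) :
    frobNorm (A * B) ≤ specNorm A * frobNorm B := by
  have hcol (k : Fin n) : ∑ i, (A * B) i k ^ 2 ≤ specNorm A ^ 2 * ∑ j, B j k ^ 2 := by
    have h := sqrt_sum_sq_mulVec_le A (fun j => B j k)
    rw [Real.sqrt_le_left (mul_nonneg (specNorm_nonneg A) (Real.sqrt_nonneg _)), mul_pow,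
      Real.sq_sqrt (by positivity)] at h
    exact h
  unfold frobNorm
  rw [Real.sqrt_le_left (mul_nonneg (specNorm_nonneg A) (Real.sqrt_nonneg _)), mul_pow,
    Real.sq_sqrt (by positivity), Finset.sum_comm, Finset.sum_comm (f := fun i j => B i j ^ 2),
    Finset.mul_sum]
  exact Finset.sum_le_sum fun k _ => hcol k

lemma abs_row_sum_le {m n : ℕ} (A : Matrix (Fin m) (Fin n) ℝ) (i : Fin m) :
    |∑ j, A i j| ≤ specNorm A * √n := by
  have h := sqrt_sum_sq_mulVec_le A (fun _ => 1)
  simp only [one_pow, Finset.sum_const, Finset.card_univ, Fintype.card_fin, nsmul_eq_mul,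
    mul_one] at h
  refine le_trans (Real.abs_le_sqrt ?_) h
  have := Finset.single_le_sum (f := fun i => (A *ᵥ fun _ => (1 : ℝ)) i ^ 2)
    (fun _ _ => sq_nonneg _) (Finset.mem_univ i)
  simpa [mulVec, dotProduct] using this

lemma inv_diagonal_eq {n : ℕ} (v : Fin n → ℝ) (hv : ∀ i, v i ≠ 0) :
    (diagonal v)⁻¹ = diagonal fun i => (v i)⁻¹ := by
  refine Matrix.inv_eq_right_inv ?_
  rw [diagonal_mul_diagonal, ← diagonal_one]
  exact congrArg diagonal (funext fun i => mul_inv_cancel₀ (hv i))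

/-- With `Ŝ = S + Δ`, `D = diag(S𝟏)`, `E = diag(Δ𝟏)`, `D̂ = D + E`,
all diagonal entries of `D` positive, `s_min = min_i D_{ii}`, `‖E‖₂ ≤ s_min/2`,
`O = D⁻¹SV` and `Ô = D̂⁻¹ŜV`:
`‖Ô − O‖_F ≤ (2/s_min + 2‖S‖₂√N/s_min²)‖Δ‖₂‖V‖_F`. -/
theorem race_end_to_end_output_error {N d : ℕ} (S Δ : Matrix (Fin N) (Fin N) ℝ)
    (hD : ∀ i, 0 < ∑ j, S i j)
    (smin : ℝ) (hmin : ∀ i, smin ≤ ∑ j, S i j) (hex : ∃ i, ∑ j, S i j = smin)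
    (hE : specNorm (rowSumDiag Δ) ≤ smin / 2)
    (V : Matrix (Fin N) (Fin d) ℝ) :
    frobNorm ((rowSumDiag S + rowSumDiag Δ)⁻¹ * (S + Δ) * V - (rowSumDiag S)⁻¹ * S * V)
      ≤ (2 / smin + 2 * specNorm S * Real.sqrt N / smin ^ 2) * specNorm Δ * frobNorm V := by
  have hs : 0 < smin := by
    obtain ⟨i, hi⟩ := hex
    exact hi ▸ hD i
  have hE_entry (i : Fin N) : |∑ j, Δ i j| ≤ smin / 2 := by
    rw [rowSumDiag, specNorm_diagonal] at hE
    exact (norm_le_pi_norm (fun i => ∑ j, Δ i j) i).trans hE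
  have hDhat (i : Fin N) : smin / 2 ≤ ∑ j, S i j + ∑ j, Δ i j := by
    linarith [hmin i, (abs_le.mp (hE_entry i)).1]
  have hDhat_pos (i : Fin N) : 0 < ∑ j, S i j + ∑ j, Δ i j := by linarith [hDhat i]
  have hDhat_inv (i : Fin N) : (∑ j, S i j + ∑ j, Δ i j)⁻¹ ≤ 2 / smin := by
    rw [← inv_div]
    exact inv_anti₀ (by positivity) (hDhat i)
  have hD_inv (i : Fin N) : (∑ j, S i j)⁻¹ ≤ smin⁻¹ := inv_anti₀ hs (hmin i)
  have hΔ := specNorm_nonneg Δ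
  have hS := specNorm_nonneg S
  have hsplit : (rowSumDiag S + rowSumDiag Δ)⁻¹ * (S + Δ) * V - (rowSumDiag S)⁻¹ * S * V =
      (diagonal (fun i => (∑ j, S i j + ∑ j, Δ i j)⁻¹) * Δ -
        diagonal (fun i => (∑ j, S i j + ∑ j, Δ i j)⁻¹ * (∑ j, S i j)⁻¹ * ∑ j, Δ i j) * S) * V := by
    rw [← Matrix.sub_mul]
    congr 1
    rw [rowSumDiag, rowSumDiag, diagonal_add, inv_diagonal_eq _ fun i => (hDhat_pos i).ne',
      inv_diagonal_eq _ fun i => (hD i).ne']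
    ext i k
    have h₁ := (hDhat_pos i).ne'
    have h₂ := (hD i).ne'
    simp only [Matrix.sub_apply, diagonal_mul, Matrix.add_apply]
    field_simp
    ring
  have hfirst : specNorm (diagonal fun i => (∑ j, S i j + ∑ j, Δ i j)⁻¹) ≤ 2 / smin := by
    rw [specNorm_diagonal, pi_norm_le_iff_of_nonneg (by positivity)]
    intro i
    rw [Real.norm_of_nonneg (inv_nonneg.mpr (hDhat_pos i).le)]
    exact hDhat_inv i
  have hsecond : specNorm (diagonal fun i =>
      (∑ j, S i j + ∑ j, Δ i j)⁻¹ * (∑ j, S i j)⁻¹ * ∑ j, Δ i j) ≤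
        2 / smin * smin⁻¹ * (specNorm Δ * √N) := by
    rw [specNorm_diagonal, pi_norm_le_iff_of_nonneg (by positivity)]
    intro i
    have h₁ := inv_nonneg.mpr (hDhat_pos i).le
    have h₂ := inv_nonneg.mpr (hD i).le
    rw [norm_mul, Real.norm_of_nonneg (mul_nonneg h₁ h₂), Real.norm_eq_abs]
    exact mul_le_mul (mul_le_mul (hDhat_inv i) (hD_inv i) h₂ (by positivity))
      (abs_row_sum_le Δ i) (abs_nonneg _) (by positivity)
  rw [hsplit]
  refine (frobNorm_mul_le _ V).trans (mul_le_mul_of_nonneg_right ?_ (Real.sqrt_nonneg _))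
  calc _ ≤ _ := specNorm_sub_le _ _
    _ ≤ _ := add_le_add (specNorm_mul_le _ _) (specNorm_mul_le _ _)
    _ ≤ 2 / smin * specNorm Δ + 2 / smin * smin⁻¹ * (specNorm Δ * √N) * specNorm S := by gcongr
    _ = _ := by
      field_simp
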